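/- Suppose (n-1)(q-1) < k < n(q-1) − (q-1)/2, and let ℓ = n(q-1) − k. Then dim(Hull(C_{n,k}^q)) = dim(C_{n,ℓ}^q) − (2ℓ + 1 − (q-1)) = C(n+ℓ, ℓ) − (2ℓ + 1 − (q-1)). -/

import Mathlib

open scoped BigOperators

/-- A vector in `F^(n+1)` is a standard representative if its leftmost nonzero
coordinate equals `1`. -/
def IsStdRep {F : Type*} [Field F] {n : ℕ} (v : Fin (n + 1) → F) : Prop :=
  ∃ i, (∀ j, j < i → v j = 0) ∧ v i = 1

/-- The set of standard affine representatives of the points of projective n-space. -/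
abbrev ProjPts (F : Type*) [Field F] (n : ℕ) : Type _ :=
  {v : Fin (n + 1) → F // IsStdRep v}

noncomputable instance {F : Type*} [Field F] [Fintype F] {n : ℕ} :
    Fintype (ProjPts F n) := Fintype.ofFinite _

/-- Evaluation of a polynomial at the standard representatives, as a linear map. -/
noncomputable def evalOnPts (F : Type*) [Field F] [Fintype F] (n : ℕ) :
    MvPolynomial (Fin (n + 1)) F →ₗ[F] (ProjPts F n → F) where
  toFun f := fun p => MvPolynomial.eval p.1 f
  map_add' f g := by ext p; simp
  map_smul' c f := by ext p; simp [MvPolynomial.smul_eval]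

/-- The projective Reed–Muller code `C_{n,k}^q`: evaluations of homogeneous degree-`k`
polynomials at the standard representatives of the points of `ℙ^n(F)`. -/
noncomputable def PRM (F : Type*) [Field F] [Fintype F] (n k : ℕ) :
    Submodule F (ProjPts F n → F) :=
  Submodule.map (evalOnPts F n) (MvPolynomial.homogeneousSubmodule (Fin (n + 1)) F k)

/-- The dual code with respect to the standard bilinear form. -/
noncomputable def dualCode {F : Type*} [Field F] [Fintype F] {n : ℕ}
    (C : Submodule F (ProjPts F n → F)) : Submodule F (ProjPts F n → F) where
  carrier := {y | ∀ c ∈ C, ∑ p : ProjPts F n, y p * c p = 0}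
  zero_mem' := by intro c hc; simp
  add_mem' := by
    intro a b ha hb c hc
    show ∑ p : ProjPts F n, (a + b) p * c p = 0
    simp only [Pi.add_apply, add_mul, Finset.sum_add_distrib, ha c hc, hb c hc, add_zero]
  smul_mem' := by
    intro r a ha c hc
    show ∑ p : ProjPts F n, (r • a) p * c p = 0
    simp only [Pi.smul_apply, smul_eq_mul, mul_assoc, ← Finset.mul_sum, ha c hc, mul_zero]

section

open MvPolynomial

variable {F : Type*} [Field F]

theorem isStdRep_cons_one {n : ℕ} (w : Fin n → F) :
    IsStdRep (Fin.cons 1 w : Fin (n + 1) → F) :=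
  ⟨0, fun j hj => absurd hj (Fin.not_lt_zero j), rfl⟩

theorem isStdRep_cons_zero {n : ℕ} {w : Fin (n + 1) → F} :
    IsStdRep (Fin.cons 0 w : Fin (n + 1 + 1) → F) ↔ IsStdRep w := by
  constructor
  · rintro ⟨i, hi, h1⟩
    induction i using Fin.cases with
    | zero => simp at h1
    | succ i =>
      exact ⟨i, fun j hj => by simpa using hi j.succ (Fin.succ_lt_succ_iff.2 hj),
        by simpa using h1⟩
  · rintro ⟨i, hi, h1⟩
    refine ⟨i.succ, fun j hj => ?_, by simpa using h1⟩
    induction j using Fin.cases with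
    | zero => rfl
    | succ j => simpa using hi j (Fin.succ_lt_succ_iff.1 hj)

theorem IsStdRep.cases {n : ℕ} {v : Fin (n + 1 + 1) → F} (hv : IsStdRep v) :
    (∃ w : Fin (n + 1) → F, v = Fin.cons 1 w) ∨
      ∃ w : Fin (n + 1) → F, IsStdRep w ∧ v = Fin.cons 0 w := by
  obtain ⟨i, hi, h1⟩ := id hv
  induction i using Fin.cases with
  | zero => exact Or.inl ⟨Fin.tail v, by rw [← h1, Fin.cons_self_tail]⟩
  | succ i =>
    have h0 : v = Fin.cons 0 (Fin.tail v) := by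
      rw [← hi 0 (Fin.succ_pos i), Fin.cons_self_tail]
    exact Or.inr ⟨Fin.tail v, isStdRep_cons_zero.1 (h0 ▸ hv), h0⟩

theorem exists_eq_smul_isStdRep {n : ℕ} {v : Fin (n + 1) → F} (hv : v ≠ 0) :
    ∃ c : F, ∃ p, IsStdRep p ∧ v = c • p := by
  classical
  have hne : (Finset.univ.filter fun i => v i ≠ 0).Nonempty := by
    obtain ⟨i, hi⟩ := Function.ne_iff.1 hv
    exact ⟨i, by simpa using hi⟩
  set i := Finset.min' _ hne with hi_def
  have hi : v i ≠ 0 := by simpa using Finset.min'_mem _ hne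
  refine ⟨v i, (v i)⁻¹ • v, ⟨i, fun j hj => ?_, by simp [hi]⟩, by simp [smul_smul, hi]⟩
  by_contra hne'
  have : v j ≠ 0 := by
    intro h
    simp [h] at hne'
  exact absurd (Finset.min'_le _ j (by simpa using this)) (not_le.2 hj)

variable [Fintype F]

theorem sum_projPts_zero (g : (Fin 1 → F) → F) :
    ∑ p : ProjPts F 0, g p.1 = g fun _ => 1 := by
  have huniq : ∀ p : ProjPts F 0, p.1 = fun _ => 1 := by
    rintro ⟨p, i, -, hi⟩
    funext j
    rwa [Fin.eq_zero i, ← Fin.eq_zero j] at hi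
  rw [Fintype.sum_eq_single (⟨fun _ => 1, 0, by simp⟩ : ProjPts F 0)]
  intro p hp
  exact absurd (Subtype.ext (huniq p)) hp

theorem sum_projPts_succ {n : ℕ} (g : ProjPts F (n + 1) → F) :
    ∑ p, g p = (∑ w : Fin (n + 1) → F, g ⟨Fin.cons 1 w, isStdRep_cons_one w⟩) +
      ∑ p : ProjPts F n, g ⟨Fin.cons 0 p.1, isStdRep_cons_zero.2 p.2⟩ := by
  let e : (Fin (n + 1) → F) ⊕ ProjPts F n → ProjPts F (n + 1) :=
    Sum.elim (fun w => ⟨Fin.cons 1 w, isStdRep_cons_one w⟩)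
      fun p => ⟨Fin.cons 0 p.1, isStdRep_cons_zero.2 p.2⟩
  have he : Function.Bijective e := by
    constructor
    · rintro (w | p) (w' | p') h
      · simpa [e] using h
      · simp [e, Fin.cons_inj] at h
      · simp [e, Fin.cons_inj] at h
      · simpa [e, Subtype.ext_iff] using h
    · rintro ⟨v, hv⟩
      rcases hv.cases with ⟨w, rfl⟩ | ⟨w, hw, rfl⟩
      · exact ⟨Sum.inl w, rfl⟩
      · exact ⟨Sum.inr ⟨w, hw⟩, rfl⟩
  rw [← he.sum_comp, Fintype.sum_sum_type]
  rfl

theorem sum_projPts_succ_of_fun {n : ℕ} (g : (Fin (n + 1 + 1) → F) → F) :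
    ∑ p : ProjPts F (n + 1), g p.1 =
      (∑ w : Fin (n + 1) → F, g (Fin.cons 1 w)) + ∑ p : ProjPts F n, g (Fin.cons 0 p.1) :=
  sum_projPts_succ fun p => g p.1

theorem sum_fin_succ_fun {n : ℕ} (g : (Fin (n + 1) → F) → F) :
    ∑ v, g v = ∑ t : F, ∑ w : Fin n → F, g (Fin.cons t w) := by
  rw [← (Fin.consEquiv fun _ => F).sum_comp, Fintype.sum_prod_type]
  rfl

theorem sum_ite_ne_zero_card (c : F) [DecidableEq F] :
    ∑ t : F, (if t = 0 then 0 else c) = -c := by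
  rw [Finset.sum_ite]
  simp [Finset.filter_ne', Finset.card_erase_of_mem, Nat.cast_sub Fintype.card_pos]

theorem sum_eq_sub_sum_projPts {n : ℕ} (g : (Fin (n + 1) → F) → F)
    (hg : ∀ (u : F) v, u ≠ 0 → g (u • v) = g v) :
    ∑ v, g v = g 0 - ∑ p : ProjPts F n, g p.1 := by
  classical
  have key : ∀ {m : ℕ} (g : (Fin (m + 1) → F) → F),
      (∀ (u : F) v, u ≠ 0 → g (u • v) = g v) →
      ∑ v, g v = (∑ w : Fin m → F, g (Fin.cons 0 w)) - ∑ w : Fin m → F, g (Fin.cons 1 w) := by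
    intro m g hg
    rw [sum_fin_succ_fun, sub_eq_add_neg, ← sum_ite_ne_zero_card,
      ← Finset.sum_add_sum_compl {(0 : F)}, Finset.sum_singleton]
    congr 1
    rw [← Finset.sum_add_sum_compl {(0 : F)} (fun t => if t = 0 then _ else _)]
    simp only [Finset.sum_singleton, if_true, zero_add]
    refine Finset.sum_congr rfl fun t ht => ?_
    have ht0 : t ≠ 0 := by simpa using ht
    rw [if_neg ht0, ← (MulAction.bijective (Units.mk0 t ht0)).sum_comp]
    refine Finset.sum_congr rfl fun w _ => ?_
    rw [← hg t (Fin.cons 1 w) ht0]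
    congr 1
    funext i
    refine Fin.cases ?_ (fun i => ?_) i <;> simp [Units.smul_def]
  induction n with
  | zero =>
    rw [key g hg, sum_projPts_zero]
    simp only [Fintype.sum_unique]
    congr 2 <;> funext i <;> rw [Fin.eq_zero i] <;> rfl
  | succ n ih =>
    rw [key g hg, ih fun w => g (Fin.cons 0 w), sum_projPts_succ_of_fun]
    · have : (Fin.cons 0 0 : Fin (n + 1 + 1) → F) = 0 := by
        funext i
        refine Fin.cases ?_ (fun i => ?_) i <;> simp
      rw [this]
      ring
    · intro u v hu
      rw [← hg u (Fin.cons 0 v) hu]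
      congr 1
      funext i
      refine Fin.cases ?_ (fun i => ?_) i <;> simp

omit [Fintype F] in
theorem MvPolynomial.IsHomogeneous.degree_eq {σ : Type*} {f : MvPolynomial σ F} {d : ℕ}
    (hf : f.IsHomogeneous d) {a : σ →₀ ℕ} (ha : a ∈ f.support) : a.degree = d := by
  rw [Finsupp.degree_eq_weight_one]
  exact hf (mem_support_iff.1 ha)

omit [Fintype F] in
theorem MvPolynomial.IsHomogeneous.eval_smul {σ : Type*} {f : MvPolynomial σ F} {d : ℕ}
    (hf : f.IsHomogeneous d) (c : F) (v : σ → F) : eval (c • v) f = c ^ d * eval v f := by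
  rw [eval_eq, eval_eq, Finset.mul_sum]
  refine Finset.sum_congr rfl fun a ha => ?_
  rw [← hf.degree_eq ha, Finsupp.degree_apply, ← Finset.prod_pow_eq_pow_sum]
  simp only [Pi.smul_apply, smul_eq_mul, mul_pow, Finset.prod_mul_distrib]
  ring

/-- The sum of a homogeneous form of degree divisible by `q - 1` over projective space vanishes,
provided that the degree is small. -/
theorem sum_projPts_eval_eq_zero {n m : ℕ} (hm : m ≠ 0) (hmn : m ≤ n)
    {f : MvPolynomial (Fin (n + 1)) F} (hf : f.IsHomogeneous (m * (Fintype.card F - 1))) :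
    ∑ p : ProjPts F n, eval p.1 f = 0 := by
  have hQ : 0 < Fintype.card F - 1 := Nat.sub_pos_of_lt Fintype.one_lt_card
  have h1 := sum_eq_sub_sum_projPts (fun v => eval v f) fun u v hu => by
    rw [hf.eval_smul, mul_comm m, pow_mul, FiniteField.pow_card_sub_one_eq_one u hu]
    simp
  have h2 : eval (0 : Fin (n + 1) → F) f = 0 := by
    have := hf.eval_smul 0 (0 : Fin (n + 1) → F)
    rwa [zero_smul, zero_pow (Nat.mul_ne_zero hm hQ.ne'), zero_mul] at this
  have h3 : ∑ v, eval v f = 0 := by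
    apply MvPolynomial.sum_eval_eq_zero
    refine hf.totalDegree_le.trans_lt ?_
    rw [mul_comm, Fintype.card_fin]
    exact Nat.mul_lt_mul_of_pos_left (by lia) hQ
  rw [h3, h2, zero_sub, eq_comm, neg_eq_zero] at h1
  exact h1

theorem eq_zero_of_evalOnPts_eq_zero {n d : ℕ} (hd0 : d ≠ 0) (hd : d < Fintype.card F)
    {f : MvPolynomial (Fin (n + 1)) F} (hf : f.IsHomogeneous d) (h : evalOnPts F n f = 0) :
    f = 0 := by
  refine MvPolynomial.eq_zero_of_eval_zero_at_prod_finset f (fun _ => Finset.univ) (fun i => ?_)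
    fun v _ => ?_
  · exact (MvPolynomial.degreeOf_le_totalDegree f i).trans_lt (hf.totalDegree_le.trans_lt hd)
  · by_cases hv : v = 0
    · have := hf.eval_smul 0 v
      rwa [zero_smul, zero_pow hd0, zero_mul, ← hv] at this
    · obtain ⟨c, p, hp, rfl⟩ := exists_eq_smul_isStdRep hv
      rw [hf.eval_smul, show eval p f = 0 from congrFun h ⟨p, hp⟩, mul_zero]

theorem sum_pow_eq_ite {m : ℕ} (hm : m < 2 * (Fintype.card F - 1)) :
    ∑ t : F, t ^ m = if m = Fintype.card F - 1 then -1 else 0 := by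
  classical
  have hcard : 1 < Fintype.card F := Fintype.one_lt_card
  rcases lt_trichotomy m (Fintype.card F - 1) with h | h | h
  · rw [if_neg h.ne, FiniteField.sum_pow_lt_card_sub_one F m h]
  · rw [if_pos h, ← sum_ite_ne_zero_card (1 : F)]
    refine Finset.sum_congr rfl fun t _ => ?_
    split_ifs with ht
    · rw [ht, zero_pow (by lia)]
    · rw [h, FiniteField.pow_card_sub_one_eq_one t ht]
  · rw [if_neg h.ne', ← FiniteField.sum_pow_lt_card_sub_one F (m - (Fintype.card F - 1)) (by lia)]
    refine Finset.sum_congr rfl fun t _ => ?_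
    rw [show m = Fintype.card F + (m - Fintype.card F) by lia, pow_add, FiniteField.pow_card,
      ← pow_succ']
    congr 1
    lia

theorem sum_prod_pow {ι : Type*} [Fintype ι] [DecidableEq ι] (a : ι → ℕ) :
    ∑ w : ι → F, ∏ i, w i ^ a i = ∏ i, ∑ t : F, t ^ a i := by
  rw [Finset.prod_univ_sum, Fintype.piFinset_univ]

theorem sum_prod_pow_eq_zero {ι : Type*} [Fintype ι] [DecidableEq ι] {a : ι → ℕ} {i : ι}
    (hi : a i < Fintype.card F - 1) : ∑ w : ι → F, ∏ i, w i ^ a i = 0 := by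
  rw [sum_prod_pow]
  exact Finset.prod_eq_zero (Finset.mem_univ i) (FiniteField.sum_pow_lt_card_sub_one F _ hi)

/-- Power sums over projective space of monomials of degree strictly between `q - 1` and
`2 (q - 1)`. -/
theorem sum_projPts_prod_pow {m s : ℕ} (hs1 : Fintype.card F - 1 < s)
    (hs2 : s < 2 * (Fintype.card F - 1)) (a : Fin (m + 1 + 1) → ℕ) (ha : ∑ i, a i = s) :
    ∑ p : ProjPts F (m + 1), ∏ i, p.1 i ^ a i =
      if ∀ i : Fin (m + 1 + 1), i.val < m → a i = 0 then
        (if a (Fin.last _) = s then 1 else 0) -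
          (if a (Fin.last _) = Fintype.card F - 1 then 1 else 0)
      else 0 := by
  rw [sum_projPts_succ_of_fun fun v => ∏ i, v i ^ a i]
  simp only [Fin.prod_univ_succ (n := m + 1), Fin.cons_zero, Fin.cons_succ, one_pow, one_mul]
  rw [← Finset.mul_sum]
  rw [Fin.sum_univ_succ] at ha
  induction m with
  | zero =>
    rw [sum_projPts_zero fun v => ∏ i, v i ^ a i.succ, sum_prod_pow]
    simp only [Fin.prod_univ_succ, Fin.sum_univ_succ, Finset.univ_eq_empty, Finset.prod_empty,
      Finset.sum_empty] at ha ⊢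
    have hlast : Fin.last (0 + 1) = Fin.succ 0 := rfl
    rw [hlast, sum_pow_eq_ite (by lia)]
    by_cases h0 : a 0 = 0
    · have : a (Fin.succ 0) = s := by lia
      have h2 : a 1 = s := this
      simp [h2, h0, hs1.ne']
    · have : a (Fin.succ 0) ≠ s := by lia
      have h2 : a 1 ≠ s := this
      simp [h0, h2]
      split_ifs <;> simp
  | succ m ih =>
    have hex : ∃ i : Fin (m + 1 + 1), a i.succ < Fintype.card F - 1 := by
      by_contra! h
      have := Finset.sum_le_sum fun i (_ : i ∈ Finset.univ) => h i
      simp only [Finset.sum_const, Finset.card_univ, Fintype.card_fin, smul_eq_mul] at this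
      have h3 : 2 * (Fintype.card F - 1) ≤ (m + 1 + 1) * (Fintype.card F - 1) :=
        Nat.mul_le_mul_right _ (by lia)
      lia
    obtain ⟨i, hi⟩ := hex
    rw [sum_prod_pow_eq_zero (a := fun i : Fin (m + 1 + 1) => a i.succ) hi, zero_add]
    by_cases h0 : a 0 = 0
    · rw [h0, pow_zero, one_mul, sum_projPts_succ_of_fun fun v => ∏ i, v i ^ a i.succ]
      simp only [Fin.prod_univ_succ (n := m + 1), Fin.cons_zero, Fin.cons_succ, one_pow, one_mul]
      rw [← Finset.mul_sum, ih (fun i => a i.succ) (by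
        rw [← Fin.sum_univ_succ fun i => a i.succ]
        lia)]
      congr 1
      rw [eq_iff_iff]
      constructor
      · intro h j hj
        induction j using Fin.cases with
        | zero => exact h0
        | succ j => exact h j (by simpa using hj)
      · intro h j hj
        exact h j.succ (by simpa using hj)
    · rw [zero_pow h0, zero_mul, if_neg]
      intro h
      exact h0 (h 0 (by simp))

omit [Fintype F] in
theorem exists_isHomogeneous_eval_cons_one {n d : ℕ} (h : MvPolynomial (Fin n) F)
    (hh : h.totalDegree ≤ d) :
    ∃ H : MvPolynomial (Fin (n + 1)) F, H.IsHomogeneous d ∧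
      ∀ w : Fin n → F, eval (Fin.cons 1 w) H = eval w h := by
  refine ⟨∑ a ∈ h.support, monomial (Finsupp.cons (d - a.degree) a) (h.coeff a), ?_, fun w => ?_⟩
  · refine IsHomogeneous.sum _ _ _ fun a ha => isHomogeneous_monomial _ ?_
    have : a.degree ≤ d := by
      refine le_trans ?_ hh
      exact le_totalDegree ha
    rw [Finsupp.degree_eq_sum, Fin.sum_univ_succ]
    simp only [Finsupp.cons_zero, Finsupp.cons_succ]
    rw [← Finsupp.degree_eq_sum]
    lia
  · rw [map_sum, eval_eq']
    refine Finset.sum_congr rfl fun a _ => ?_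
    rw [eval_monomial, Finsupp.prod_fintype _ _ (by simp), Fin.prod_univ_succ]
    simp

theorem exists_isHomogeneous_eval_eq_indicator {m k : ℕ} (hk : m * (Fintype.card F - 1) < k)
    (p : ProjPts F m) :
    ∃ g : MvPolynomial (Fin (m + 1)) F, g.IsHomogeneous k ∧ eval p.1 g = 1 ∧
      ∀ r : ProjPts F m, r ≠ p → eval r.1 g = 0 := by
  classical
  have hcard : 1 < Fintype.card F := Fintype.one_lt_card
  obtain ⟨i, hi, h1⟩ := p.2
  refine ⟨X i ^ (k - m * (Fintype.card F - 1)) * ∏ j ∈ Finset.univ.erase i,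
    (X i ^ (Fintype.card F - 1) - (X j - C (p.1 j) * X i) ^ (Fintype.card F - 1)), ?_, ?_, ?_⟩
  · have h2 := IsHomogeneous.prod (Finset.univ.erase i) (fun j =>
      (X i ^ (Fintype.card F - 1) - (X j - C (p.1 j) * X i) ^ (Fintype.card F - 1) :
        MvPolynomial (Fin (m + 1)) F)) (fun _ => Fintype.card F - 1) fun j _ => by
      have hX := isHomogeneous_X F i
      refine IsHomogeneous.sub ?_ ?_
      · simpa using hX.pow (Fintype.card F - 1)
      · simpa using ((isHomogeneous_X F j).sub (hX.C_mul (p.1 j))).pow (Fintype.card F - 1)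
    have h3 := ((isHomogeneous_X F i).pow (k - m * (Fintype.card F - 1))).mul h2
    convert h3 using 1
    simp
    lia
  · simp only [map_mul, map_pow, eval_X, map_prod, map_sub, eval_C, h1, one_pow, one_mul, mul_one,
      sub_self]
    rw [zero_pow (by lia)]
    simp
  · intro r hr
    by_contra hne
    apply hr
    simp only [map_mul, map_pow, eval_X, map_prod, map_sub, eval_C] at hne
    obtain ⟨hne1, hne2⟩ := mul_ne_zero_iff.1 hne
    have hri : r.1 i ≠ 0 := fun h => hne1 (by rw [h, zero_pow (by lia)])
    have hrj : ∀ j, r.1 j = p.1 j * r.1 i := by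
      intro j
      by_cases hj : j = i
      · rw [hj, h1, one_mul]
      · have := Finset.prod_ne_zero_iff.1 hne2 j (by simpa using hj)
        by_contra h
        apply this
        rw [FiniteField.pow_card_sub_one_eq_one _ hri,
          FiniteField.pow_card_sub_one_eq_one _ (sub_ne_zero.2 h), sub_self]
    obtain ⟨i', hi', h1'⟩ := r.2
    have hii : i' = i := by
      rcases lt_trichotomy i' i with h | h | h
      · have := hrj i'
        rw [hi _ h, h1', zero_mul] at this
        exact absurd this one_ne_zero
      · exact h
      · exact absurd (hi' _ h) hri
    refine Subtype.ext (funext fun j => ?_)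
    rw [hrj, ← hii, h1', mul_one]

theorem mem_PRM {n k : ℕ} {y : ProjPts F n → F} :
    y ∈ PRM F n k ↔
      ∃ f : MvPolynomial (Fin (n + 1)) F, f.IsHomogeneous k ∧ evalOnPts F n f = y :=
  Iff.rfl

theorem mem_dualCode_PRM {n k : ℕ} {y : ProjPts F n → F} :
    y ∈ dualCode (PRM F n k) ↔ ∀ f : MvPolynomial (Fin (n + 1)) F, f.IsHomogeneous k →
      ∑ p : ProjPts F n, y p * eval p.1 f = 0 := by
  constructor
  · intro h f hf
    exact h _ (mem_PRM.2 ⟨f, hf, rfl⟩)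
  · rintro h _ ⟨f, hf, rfl⟩
    exact h f hf

theorem PRM_le_dualCode_PRM {n k l m : ℕ} (hm : m ≠ 0) (hmn : m ≤ n)
    (hlk : l + k = m * (Fintype.card F - 1)) : PRM F n l ≤ dualCode (PRM F n k) := by
  rintro _ ⟨f, hf, rfl⟩
  refine mem_dualCode_PRM.2 fun g hg => ?_
  have := sum_projPts_eval_eq_zero hm hmn (hlk ▸ hf.mul hg)
  simp only [map_mul] at this
  exact this

/-- A reduced polynomial orthogonal to all monomials of degree less than `k` has degree at most
`n (q - 1) - k`. -/
theorem totalDegree_le_of_orthogonal {n k l : ℕ} (hlk : l + k = n * (Fintype.card F - 1))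
    {h : MvPolynomial (Fin n) F} (hh : h ∈ restrictDegree (Fin n) F (Fintype.card F - 1))
    (horth : ∀ b : Fin n →₀ ℕ, b.degree < k →
      ∑ w : Fin n → F, eval w h * ∏ i, w i ^ b i = 0) :
    h.totalDegree ≤ l := by
  have hcard : 1 < Fintype.card F := Fintype.one_lt_card
  rw [mem_restrictDegree] at hh
  by_contra! hl
  have hne : h.support.Nonempty := by
    rw [Finset.nonempty_iff_ne_empty, Ne, support_eq_empty]
    rintro rfl
    simp at hl
  obtain ⟨a, ha, hmax⟩ := Finset.exists_max_image h.support Finsupp.degree hne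
  have hla : l < a.degree := by
    refine hl.trans_le ?_
    rw [totalDegree]
    exact Finset.sup_le fun b hb => hmax b hb
  let b : Fin n →₀ ℕ := Finsupp.equivFunOnFinite.symm fun i => Fintype.card F - 1 - a i
  have hb : ∀ i, a i + b i = Fintype.card F - 1 := fun i => by
    have := hh a ha i
    simp only [b, Finsupp.equivFunOnFinite_symm_apply_apply]
    lia
  have hab : a.degree + b.degree = n * (Fintype.card F - 1) := by
    rw [Finsupp.degree_eq_sum, Finsupp.degree_eq_sum, ← Finset.sum_add_distrib]
    simp [hb]
  have hsum := horth b (by lia)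
  simp only [eval_eq', Finset.sum_mul] at hsum
  rw [Finset.sum_comm] at hsum
  simp only [mul_assoc, ← Finset.prod_mul_distrib, ← pow_add, ← Finset.mul_sum] at hsum
  rw [Finset.sum_eq_single a] at hsum
  · rw [sum_prod_pow (fun i => a i + b i)] at hsum
    simp only [hb, sum_pow_eq_ite (show Fintype.card F - 1 < 2 * (Fintype.card F - 1) by lia),
      if_true] at hsum
    exact mem_support_iff.1 ha (by simpa using hsum)
  · intro a' ha' hne'
    have : ∃ i, a' i < a i := by
      by_contra! hle
      have h1 : a ≤ a' := hle
      obtain ⟨c, rfl⟩ := exists_add_of_le h1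
      have h2 := hmax _ ha'
      rw [map_add] at h2
      have h3 : c = 0 := by
        rw [← Finsupp.degree_eq_zero_iff]
        lia
      exact hne' (by rw [h3, add_zero])
    obtain ⟨i, hi⟩ := this
    rw [sum_prod_pow_eq_zero (a := fun i => a' i + b i) (i := i), mul_zero]
    have := hb i
    lia
  · exact fun h => absurd ha h

theorem dualCode_PRM_le_PRM {m k l : ℕ} (hk : m * (Fintype.card F - 1) < k)
    (hlk : l + k = (m + 1) * (Fintype.card F - 1)) :
    dualCode (PRM F (m + 1) k) ≤ PRM F (m + 1) l := by
  intro y hy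
  have hy' := mem_dualCode_PRM.1 hy
  have hmem : (fun w : Fin (m + 1) → F => y ⟨Fin.cons 1 w, isStdRep_cons_one w⟩) ∈
      (restrictDegree (Fin (m + 1)) F (Fintype.card F - 1)).map (evalₗ F (Fin (m + 1))) := by
    rw [map_restrict_dom_evalₗ]
    trivial
  obtain ⟨h, hh, hhy⟩ := hmem
  have hhy' : ∀ w, eval w h = y ⟨Fin.cons 1 w, isStdRep_cons_one w⟩ := congrFun hhy
  have hdeg : h.totalDegree ≤ l := by
    refine totalDegree_le_of_orthogonal hlk hh fun b hb => ?_
    obtain ⟨M, hM, hMb⟩ : ∃ M : MvPolynomial (Fin (m + 1 + 1)) F, M.IsHomogeneous (k - 1) ∧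
        ∀ w : Fin (m + 1) → F, eval (Fin.cons 1 w) M = eval w (monomial b 1) :=
      exists_isHomogeneous_eval_cons_one (monomial b 1)
        ((totalDegree_monomial_le b 1).trans (by
          change b.degree ≤ k - 1
          lia))
    have := hy' (X 0 * M) (by
      have := (isHomogeneous_X F 0).mul hM
      rwa [show 1 + (k - 1) = k by lia] at this)
    rw [sum_projPts_succ] at this
    simpa [hMb, hhy', eval_monomial, Finsupp.prod_fintype] using this
  obtain ⟨H, hH, hHh⟩ := exists_isHomogeneous_eval_cons_one h hdeg
  refine mem_PRM.2 ⟨H, hH, ?_⟩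
  have hH' : evalOnPts F (m + 1) H ∈ dualCode (PRM F (m + 1) k) :=
    PRM_le_dualCode_PRM (Nat.succ_ne_zero m) le_rfl hlk (mem_PRM.2 ⟨H, hH, rfl⟩)
  have hz := mem_dualCode_PRM.1 (Submodule.sub_mem _ hH' hy)
  have hz1 : ∀ w, (evalOnPts F (m + 1) H - y) ⟨Fin.cons 1 w, isStdRep_cons_one w⟩ = 0 := fun w => by
    rw [Pi.sub_apply, ← hhy', ← hHh, sub_eq_zero]
    rfl
  rw [← sub_eq_zero]
  funext ⟨v, hv⟩
  rcases hv.cases with ⟨w, rfl⟩ | ⟨w, hw, rfl⟩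
  · exact hz1 w
  · obtain ⟨g, hg, hg1, hg0⟩ := exists_isHomogeneous_eval_eq_indicator hk ⟨w, hw⟩
    have h1 := hz _ (hg.rename_isHomogeneous (f := Fin.succ))
    rw [sum_projPts_succ] at h1
    simp only [hz1, zero_mul, Finset.sum_const_zero, zero_add, eval_rename] at h1
    have hcons : ∀ r : Fin (m + 1) → F, (Fin.cons 0 r : Fin (m + 1 + 1) → F) ∘ Fin.succ = r :=
      fun r => rfl
    simp only [hcons] at h1
    rw [Finset.sum_eq_single ⟨w, hw⟩] at h1
    · rwa [hg1, mul_one] at h1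
    · intro r _ hr
      rw [hg0 r hr, mul_zero]
    · simp

theorem mem_of_orthogonal_dualCode {n : ℕ} {C : Submodule F (ProjPts F n → F)}
    {c : ProjPts F n → F} (hc : ∀ y ∈ dualCode C, ∑ p, y p * c p = 0) : c ∈ C := by
  classical
  by_contra hcC
  obtain ⟨φ, hφ, hle⟩ := Submodule.exists_le_ker_of_notMem hcC
  have hrep : ∀ x : ProjPts F n → F, φ x = ∑ p, φ (Pi.single p 1) * x p := by
    intro x
    conv_lhs => rw [pi_eq_sum_univ' x]
    simp [map_sum, mul_comm]
  apply hφ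
  rw [hrep]
  refine hc (fun p => φ (Pi.single p 1)) fun x hx => ?_
  rw [← hrep]
  exact hle hx

theorem sum_projPts_eval_mul_eval {n : ℕ} (f g : MvPolynomial (Fin (n + 1)) F) :
    ∑ p : ProjPts F n, eval p.1 f * eval p.1 g =
      ∑ a ∈ f.support, ∑ d ∈ g.support,
        f.coeff a * g.coeff d * ∑ p : ProjPts F n, ∏ i, p.1 i ^ (a i + d i) := by
  have : ∀ p : ProjPts F n, eval p.1 f * eval p.1 g = ∑ a ∈ f.support, ∑ d ∈ g.support,
      f.coeff a * g.coeff d * ∏ i, p.1 i ^ (a i + d i) := fun p => by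
    rw [eval_eq', eval_eq', Finset.sum_mul_sum]
    refine Finset.sum_congr rfl fun a _ => Finset.sum_congr rfl fun d _ => ?_
    simp only [pow_add, Finset.prod_mul_distrib]
    ring
  simp only [this, Finset.mul_sum]
  rw [Finset.sum_comm]
  exact Finset.sum_congr rfl fun a _ => Finset.sum_comm

/-- Exponents of monomials of degree `l` in the last two variables in which the last variable
occurs at least `c` times. -/
def lastPairExponents (m l c : ℕ) : Set (Fin (m + 1 + 1) →₀ ℕ) :=
  {a | a.degree = l ∧ (∀ i : Fin (m + 1 + 1), i.val < m → a i = 0) ∧ c ≤ a (Fin.last _)}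

/-- The exponent of the monomial `x_m ^ (l - b) * x_{m+1} ^ b`. -/
noncomputable def lastPairExponent (m l b : ℕ) : Fin (m + 1 + 1) →₀ ℕ :=
  Finsupp.single (Fin.last m).castSucc (l - b) + Finsupp.single (Fin.last (m + 1)) b

theorem lastPairExponent_apply_last (m l b : ℕ) :
    lastPairExponent m l b (Fin.last (m + 1)) = b := by
  have : (Fin.last m).castSucc ≠ Fin.last (m + 1) := (Fin.castSucc_lt_last _).ne
  simp [lastPairExponent, this]

theorem lastPairExponent_apply_of_lt {m l b : ℕ} {i : Fin (m + 1 + 1)} (hi : i.val < m) :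
    lastPairExponent m l b i = 0 := by
  have h1 : (Fin.last m).castSucc ≠ i := fun h => by simp [← h] at hi
  have h2 : Fin.last (m + 1) ≠ i := fun h => by simp [← h] at hi
  simp [lastPairExponent, h1, h2]

theorem degree_lastPairExponent {m l b : ℕ} (hb : b ≤ l) :
    (lastPairExponent m l b).degree = l := by
  rw [lastPairExponent, map_add, Finsupp.degree_single, Finsupp.degree_single]
  lia

theorem eq_of_apply_last_eq {m l : ℕ} {a b : Fin (m + 1 + 1) →₀ ℕ} (ha : a.degree = l)
    (hb : b.degree = l) (ha0 : ∀ i : Fin (m + 1 + 1), i.val < m → a i = 0)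
    (hb0 : ∀ i : Fin (m + 1 + 1), i.val < m → b i = 0)
    (h : a (Fin.last (m + 1)) = b (Fin.last (m + 1))) : a = b := by
  rw [Finsupp.degree_eq_sum, Fin.sum_univ_castSucc, Fin.sum_univ_castSucc] at ha hb
  rw [Finset.sum_eq_zero fun i _ => ha0 i.castSucc.castSucc i.2] at ha
  rw [Finset.sum_eq_zero fun i _ => hb0 i.castSucc.castSucc i.2] at hb
  ext i
  induction i using Fin.lastCases with
  | last => exact h
  | cast i =>
    induction i using Fin.lastCases with
    | last => lia
    | cast i => rw [ha0 i.castSucc.castSucc i.2, hb0 i.castSucc.castSucc i.2]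

theorem lastPairExponents_eq_image (m l c : ℕ) :
    lastPairExponents m l c = lastPairExponent m l '' (Finset.Icc c l) := by
  ext a
  constructor
  · rintro ⟨ha, ha0, hc⟩
    have hl : a (Fin.last _) ≤ l := ha ▸ Finsupp.le_degree _ a
    exact ⟨a (Fin.last _), by simp [hc, hl], eq_of_apply_last_eq (degree_lastPairExponent hl) ha
      (fun i hi => lastPairExponent_apply_of_lt hi) ha0 (lastPairExponent_apply_last ..)⟩
  · rintro ⟨b, hb, rfl⟩
    rw [Finset.mem_coe, Finset.mem_Icc] at hb
    exact ⟨degree_lastPairExponent hb.2, fun i hi => lastPairExponent_apply_of_lt hi,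
      by rw [lastPairExponent_apply_last]; exact hb.1⟩

theorem ncard_lastPairExponents (m l c : ℕ) : (lastPairExponents m l c).ncard = l + 1 - c := by
  rw [lastPairExponents_eq_image, Set.ncard_image_of_injective, Set.ncard_coe_finset, Nat.card_Icc]
  intro a b h
  rw [← lastPairExponent_apply_last m l a, h, lastPairExponent_apply_last]

theorem sum_projPts_prod_pow_add {m l : ℕ} (hl1 : Fintype.card F - 1 < 2 * l)
    (hl2 : l < Fintype.card F - 1) {a d : Fin (m + 1 + 1) →₀ ℕ} (ha : a.degree = l)
    (hd : d.degree = l) :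
    ∑ p : ProjPts F (m + 1), ∏ i, p.1 i ^ (a i + d i) =
      if ∀ i : Fin (m + 1 + 1), i.val < m → a i + d i = 0 then
        (if a (Fin.last _) + d (Fin.last _) = 2 * l then 1 else 0) -
          (if a (Fin.last _) + d (Fin.last _) = Fintype.card F - 1 then 1 else 0)
      else 0 := by
  refine sum_projPts_prod_pow hl1 (by lia) (fun i => a i + d i) ?_
  rw [Finset.sum_add_distrib, ← Finsupp.degree_eq_sum, ← Finsupp.degree_eq_sum, ha, hd, two_mul]

/-- The radical of the standard form on forms of degree `l`, where `(q - 1) / 2 < l < q - 1`. -/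
theorem evalOnPts_mem_dualCode_PRM_iff {m l : ℕ} (hl1 : Fintype.card F - 1 < 2 * l)
    (hl2 : l < Fintype.card F - 1) {f : MvPolynomial (Fin (m + 1 + 1)) F}
    (hf : f.IsHomogeneous l) :
    evalOnPts F (m + 1) f ∈ dualCode (PRM F (m + 1) l) ↔
      ∀ a ∈ lastPairExponents m l (Fintype.card F - 1 - l), f.coeff a = 0 := by
  rw [mem_dualCode_PRM]
  constructor
  · intro h
    have key : ∀ a ∈ lastPairExponents m l (Fintype.card F - 1 - l),
        (∀ b ∈ f.support, (∀ i : Fin (m + 1 + 1), i.val < m → b i = 0) →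
          b (Fin.last _) + (Fintype.card F - 1 - a (Fin.last _)) ≠ 2 * l) → f.coeff a = 0 := by
      rintro a ⟨had, ha0, hal⟩ hb
      have hal' : a (Fin.last _) ≤ l := had ▸ Finsupp.le_degree _ a
      set c := Fintype.card F - 1 - a (Fin.last _) with hc
      have hcl : c ≤ l := by lia
      by_contra hne
      have h1 : ∑ p : ProjPts F (m + 1),
          eval p.1 f * eval p.1 (monomial (lastPairExponent m l c) (1 : F)) = 0 :=
        h _ (isHomogeneous_monomial _ (degree_lastPairExponent hcl))
      classical
      rw [sum_projPts_eval_mul_eval, support_monomial, if_neg one_ne_zero] at h1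
      simp only [Finset.sum_singleton, coeff_monomial, if_true, mul_one] at h1
      have ha : a ∈ f.support := mem_support_iff.2 hne
      rw [Finset.sum_eq_single_of_mem a ha] at h1
      · rw [sum_projPts_prod_pow_add hl1 hl2 had (degree_lastPairExponent hcl), if_pos,
          lastPairExponent_apply_last, if_neg (hb a ha ha0), if_pos (by lia)] at h1
        · exact hne (by simpa using h1)
        · intro i hi
          rw [ha0 i hi, lastPairExponent_apply_of_lt hi]
      · intro b hbs hba
        rw [sum_projPts_prod_pow_add hl1 hl2 (hf.degree_eq hbs) (degree_lastPairExponent hcl)]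
        split_ifs with h2 h3 h4 h4
        · rw [lastPairExponent_apply_last] at h3
          exact absurd h3 (hb b hbs fun i hi => (Nat.add_eq_zero_iff.1 (h2 i hi)).1)
        · rw [lastPairExponent_apply_last] at h3
          exact absurd h3 (hb b hbs fun i hi => (Nat.add_eq_zero_iff.1 (h2 i hi)).1)
        · rw [lastPairExponent_apply_last] at h4
          exact absurd (eq_of_apply_last_eq (hf.degree_eq hbs) had
            (fun i hi => (Nat.add_eq_zero_iff.1 (h2 i hi)).1) ha0 (by lia)) hba
        · simp
        · simp
    have hgt : ∀ a ∈ lastPairExponents m l (Fintype.card F - 1 - l),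
        Fintype.card F - 1 - l < a (Fin.last _) → f.coeff a = 0 := fun a ha hlt =>
      key a ha fun b hb _ => by
        have : b (Fin.last _) ≤ l := hf.degree_eq hb ▸ Finsupp.le_degree _ b
        lia
    intro a ha
    refine key a ha fun b hb hb0 hbl => ?_
    have h1 : b (Fin.last _) ≤ l := hf.degree_eq hb ▸ Finsupp.le_degree _ b
    have h2 := ha.2.2
    exact mem_support_iff.1 hb (hgt b ⟨hf.degree_eq hb, hb0, by lia⟩ (by lia))
  · intro h g hg
    change ∑ p : ProjPts F (m + 1), eval p.1 f * eval p.1 g = 0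
    rw [sum_projPts_eval_mul_eval]
    refine Finset.sum_eq_zero fun a ha => Finset.sum_eq_zero fun d hd => ?_
    by_cases haE : a ∈ lastPairExponents m l (Fintype.card F - 1 - l)
    · rw [h a haE, zero_mul, zero_mul]
    · rw [sum_projPts_prod_pow_add hl1 hl2 (hf.degree_eq ha) (hg.degree_eq hd)]
      by_cases h2 : ∀ i : Fin (m + 1 + 1), i.val < m → a i + d i = 0
      · have h3 : a (Fin.last _) < Fintype.card F - 1 - l := by
          by_contra! h4
          exact haE ⟨hf.degree_eq ha, fun i hi => (Nat.add_eq_zero_iff.1 (h2 i hi)).1, h4⟩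
        have h4 : d (Fin.last _) ≤ l := hg.degree_eq hd ▸ Finsupp.le_degree _ d
        rw [if_pos h2, if_neg (by lia), if_neg (by lia), sub_zero, mul_zero]
      · rw [if_neg h2, mul_zero]

omit [Fintype F] in
theorem homogeneousSubmodule_eq_restrictSupport (σ : Type*) (d : ℕ) :
    homogeneousSubmodule σ F d = restrictSupport F {a | a.degree = d} :=
  homogeneousSubmodule_eq_finsupp_supported σ F d

theorem finrank_map_evalOnPts_restrictSupport {n d : ℕ} (hd0 : d ≠ 0) (hd : d < Fintype.card F)
    {s : Set (Fin (n + 1) →₀ ℕ)} (hs : s ⊆ {a | a.degree = d}) :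
    Module.finrank F ((restrictSupport F s).map (evalOnPts F n)) = s.ncard := by
  rw [← LinearMap.range_domRestrict, LinearMap.finrank_range_of_inj,
    Module.finrank_eq_nat_card_basis (basisRestrictSupport F s)]
  · rfl
  · rw [← LinearMap.ker_eq_bot, LinearMap.ker_eq_bot']
    rintro ⟨f, hf⟩ h
    have hf' : f ∈ homogeneousSubmodule (Fin (n + 1)) F d := by
      rw [homogeneousSubmodule_eq_restrictSupport]
      exact restrictSupport_mono F hs hf
    exact Subtype.ext (eq_zero_of_evalOnPts_eq_zero hd0 hd hf' h)

theorem ncard_degree_eq (n d : ℕ) :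
    {a : Fin (n + 1) →₀ ℕ | a.degree = d}.ncard = (n + d).choose d := by
  have : {a : Fin (n + 1) →₀ ℕ | a.degree = d} =
      (Finset.univ.finsuppAntidiag d : Finset (Fin (n + 1) →₀ ℕ)) := by
    ext a
    simp [Finset.mem_finsuppAntidiag, Finsupp.degree_eq_sum]
  rw [this, Set.ncard_coe_finset, Finset.card_finsuppAntidiag_nat_eq_choose]
  simp only [Finset.card_univ, Fintype.card_fin]
  rw [show n + 1 + d - 1 = n + d by lia]

theorem PRM_inf_dualCode_PRM_eq_map {m k l : ℕ} (hk : m * (Fintype.card F - 1) < k)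
    (hlk : l + k = (m + 1) * (Fintype.card F - 1)) (hl1 : Fintype.card F - 1 < 2 * l)
    (hl2 : l < Fintype.card F - 1) :
    PRM F (m + 1) k ⊓ dualCode (PRM F (m + 1) k) =
      (restrictSupport F ({a | a.degree = l} \
        lastPairExponents m l (Fintype.card F - 1 - l))).map (evalOnPts F (m + 1)) := by
  have hle : dualCode (PRM F (m + 1) k) ≤ PRM F (m + 1) l := dualCode_PRM_le_PRM hk hlk
  have hge : PRM F (m + 1) l ≤ dualCode (PRM F (m + 1) k) :=
    PRM_le_dualCode_PRM (Nat.succ_ne_zero m) le_rfl hlk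
  have hmem : ∀ {f : MvPolynomial (Fin (m + 1 + 1)) F},
      f ∈ restrictSupport F ({a | a.degree = l} \
        lastPairExponents m l (Fintype.card F - 1 - l)) ↔
      f.IsHomogeneous l ∧ ∀ a ∈ lastPairExponents m l (Fintype.card F - 1 - l),
        f.coeff a = 0 := by
    intro f
    rw [← mem_homogeneousSubmodule, homogeneousSubmodule_eq_restrictSupport,
      mem_restrictSupport_iff, mem_restrictSupport_iff, Set.subset_sdiff, Set.disjoint_right]
    simp
  ext y
  constructor
  · rintro ⟨hy, hy'⟩
    obtain ⟨f, hf, rfl⟩ := hle hy'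
    refine ⟨f, hmem.2 ⟨hf, (evalOnPts_mem_dualCode_PRM_iff hl1 hl2 hf).1 ?_⟩, rfl⟩
    intro c hc
    have := hge hc _ hy
    simpa only [mul_comm] using this
  · rintro ⟨f, hf, rfl⟩
    obtain ⟨hf1, hf2⟩ := hmem.1 hf
    refine ⟨mem_of_orthogonal_dualCode fun c hc => ?_, hge ⟨f, hf1, rfl⟩⟩
    have := (evalOnPts_mem_dualCode_PRM_iff hl1 hl2 hf1).2 hf2 c (hle hc)
    simpa only [mul_comm] using this

end

theorem stmt19 (q n : ℕ) (F : Type*) [Field F] [Fintype F] [DecidableEq F]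
    (hq : Fintype.card F = q) (hn : 1 ≤ n) (k : ℕ) (hk1 : (n - 1) * (q - 1) < k)
    (hk2 : 2 * k < (2 * n - 1) * (q - 1)) :
    (Module.finrank F ↥(PRM F n k ⊓ dualCode (PRM F n k)) : ℤ) =
        (Module.finrank F (PRM F n (n * (q - 1) - k)) : ℤ) -
          (2 * ((n * (q - 1) - k : ℕ) : ℤ) + 1 - ((q : ℤ) - 1)) ∧
    (Module.finrank F (PRM F n (n * (q - 1) - k)) : ℤ)
      = (((n + (n * (q - 1) - k)).choose (n * (q - 1) - k) : ℕ) : ℤ) := by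
  subst hq
  obtain ⟨m, rfl⟩ := Nat.exists_eq_add_of_le' hn
  have hcard : 1 < Fintype.card F := Fintype.one_lt_card
  obtain ⟨l, hl⟩ : ∃ l, l = (m + 1) * (Fintype.card F - 1) - k := ⟨_, rfl⟩
  rw [← hl]
  rw [Nat.add_sub_cancel] at hk1
  rw [show 2 * (m + 1) - 1 = 2 * m + 1 by lia] at hk2
  have e1 : (m + 1) * (Fintype.card F - 1) =
    m * (Fintype.card F - 1) + (Fintype.card F - 1) := by ring
  have e2 : (2 * m + 1) * (Fintype.card F - 1) =
    2 * (m * (Fintype.card F - 1)) + (Fintype.card F - 1) := by ring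
  have hlk : l + k = (m + 1) * (Fintype.card F - 1) := by lia
  have hl1 : Fintype.card F - 1 < 2 * l := by lia
  have hl2 : l < Fintype.card F - 1 := by lia
  have hsub : lastPairExponents m l (Fintype.card F - 1 - l) ⊆ {a | a.degree = l} :=
    fun a ha => ha.1
  have hfin : (lastPairExponents m l (Fintype.card F - 1 - l)).Finite := by
    rw [lastPairExponents_eq_image]
    exact (Finset.finite_toSet _).image _
  have hdim : Module.finrank F (PRM F (m + 1) l) = (m + 1 + l).choose l := by
    rw [PRM, homogeneousSubmodule_eq_restrictSupport,
      finrank_map_evalOnPts_restrictSupport (by lia) (by lia) subset_rfl, ncard_degree_eq]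
  have hpos : (lastPairExponents m l (Fintype.card F - 1 - l)).ncard ≤
      {a : Fin (m + 1 + 1) →₀ ℕ | a.degree = l}.ncard :=
    Set.ncard_le_ncard hsub (Set.finite_of_ncard_pos (by
      rw [ncard_degree_eq]
      exact Nat.choose_pos (by lia)))
  refine ⟨?_, by rw [hdim]⟩
  rw [PRM_inf_dualCode_PRM_eq_map hk1 hlk hl1 hl2,
    finrank_map_evalOnPts_restrictSupport (by lia) (by lia) Set.sdiff_subset,
    Set.ncard_sdiff hsub hfin, hdim, Nat.cast_sub hpos, ncard_degree_eq, ncard_lastPairExponents]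
  lia
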